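/- (Completeness of CP for free valuation congruence) If P =_fr Q for propositional statements P and Q, where fr is the class of all valuation algebras, then CP ⊢ P = Q. -/

import Mathlib

/-- Propositional statements over atoms `A`: constants `T`, `F`, an atom `a`
for each `a ∈ A`, and the ternary conditional composition
`cond x y z = x ◁ y ▷ z` (with `y` the central condition). -/
inductive PS (A : Type) : Type where
  | tt : PS A
  | ff : PS A
  | atom : A → PS A
  | cond : PS A → PS A → PS A → PS A

/-- A valuation algebra (VA) over `A`. -/
structure VA (A : Type) where
  Val : Type
  Tv : Val
  Fv : Val
  yd : A → Val → Bool
  dv : A → Val → Val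
  yd_T : ∀ a, yd a Tv = true
  yd_F : ∀ a, yd a Fv = false
  dv_T : ∀ a, dv a Tv = Tv
  dv_F : ∀ a, dv a Fv = Fv

variable {A : Type}

mutual
  /-- Evaluation `P/H` of a propositional statement over a valuation `H`. -/
  def PS.eval (V : VA A) : PS A → V.Val → Bool
    | .tt, _ => true
    | .ff, _ => false
    | .atom a, H => V.yd a H
    | .cond p q r, H =>
        if PS.eval V q H then PS.eval V p (PS.deriv V q H)
        else PS.eval V r (PS.deriv V q H)
  /-- The generalized derivative `∂_P(H)`. -/
  def PS.deriv (V : VA A) : PS A → V.Val → V.Val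
    | .tt, H => H
    | .ff, H => H
    | .atom a, H => V.dv a H
    | .cond p q r, H =>
        if PS.eval V q H then PS.deriv V p (PS.deriv V q H)
        else PS.deriv V r (PS.deriv V q H)
end

/-- `K`-equivalence: equal evaluation results in all members of the class `K`. -/
def KEquiv (K : VA A → Prop) (P Q : PS A) : Prop :=
  ∀ V : VA A, K V → ∀ H : V.Val, PS.eval V P H = PS.eval V Q H

/-- A congruence with respect to conditional composition. -/
def IsCondCongruence (R : PS A → PS A → Prop) : Prop :=
  Equivalence R ∧
    ∀ ⦃x x' y y' z z' : PS A⦄, R x x' → R y y' → R z z' →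
      R (PS.cond x y z) (PS.cond x' y' z')

/-- `K`-congruence: the largest congruence contained in `K`-equivalence. -/
def KCong (K : VA A → Prop) (P Q : PS A) : Prop :=
  ∃ R : PS A → PS A → Prop,
    IsCondCongruence R ∧ (∀ x y, R x y → KEquiv K x y) ∧ R P Q

/-- Derivability (of closed equations) in equational logic from the axioms `CP`
together with an additional set `Ax` of equational axioms. -/
inductive Deriv (Ax : PS A → PS A → Prop) : PS A → PS A → Prop where
  | ax {p q} : Ax p q → Deriv Ax p q
  | cp1 (x y) : Deriv Ax (.cond x .tt y) x
  | cp2 (x y) : Deriv Ax (.cond x .ff y) y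
  | cp3 (x) : Deriv Ax (.cond .tt x .ff) x
  | cp4 (x y z u v) :
      Deriv Ax (.cond x (.cond y z u) v)
               (.cond (.cond x y v) z (.cond x u v))
  | refl (x) : Deriv Ax x x
  | symm {p q} : Deriv Ax p q → Deriv Ax q p
  | trans {p q r} : Deriv Ax p q → Deriv Ax q r → Deriv Ax p r
  | congr {x x' y y' z z'} : Deriv Ax x x' → Deriv Ax y y' → Deriv Ax z z' →
      Deriv Ax (.cond x y z) (.cond x' y' z')

/-- No additional axioms: plain `CP`. -/
def NoAx : PS A → PS A → Prop := fun _ _ => False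

/-- The class `fr` of free valuation algebras: all VAs. -/
def frK : VA A → Prop := fun _ => True

/-- The class `rp` of repetition-proof VAs. -/
def rpK (V : VA A) : Prop :=
  ∀ (a : A) (x : V.Val), V.yd a x = V.yd a (V.dv a x)

/-- The class `cr` of contractive VAs. -/
def crK (V : VA A) : Prop :=
  rpK V ∧ ∀ (a : A) (x : V.Val), V.dv a (V.dv a x) = V.dv a x

/-- The class `wm` of weakly memorizing VAs. -/
def wmK (V : VA A) : Prop :=
  crK V ∧ ∀ (a b : A) (x : V.Val),
    V.yd b (V.dv a x) = V.yd a x →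
      V.dv a (V.dv b (V.dv a x)) = V.dv b (V.dv a x) ∧
      V.yd a (V.dv b (V.dv a x)) = V.yd a x

/-- The class `mem` of memorizing VAs. -/
def memK (V : VA A) : Prop :=
  crK V ∧ ∀ (a b : A) (x : V.Val),
    V.dv a (V.dv b (V.dv a x)) = V.dv b (V.dv a x) ∧
    V.yd a (V.dv b (V.dv a x)) = V.yd a x

/-- The class `st` of static VAs. -/
def stK (V : VA A) : Prop :=
  ∀ (a b : A) (x : V.Val), V.yd a (V.dv b x) = V.yd a x

/-- Basic forms: binary decision trees with inner nodes labelled by atoms. -/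
inductive BasicForm (A : Type) : Type where
  | tt : BasicForm A
  | ff : BasicForm A
  | node : A → BasicForm A → BasicForm A → BasicForm A

/-- The propositional statement denoted by a basic form. -/
def BasicForm.toPS : BasicForm A → PS A
  | .tt => .tt
  | .ff => .ff
  | .node a l r => .cond l.toPS (.atom a) r.toPS

/-- Replace the leaves `T` by `p` and the leaves `F` by `r`. -/
def BasicForm.graft (p r : BasicForm A) : BasicForm A → BasicForm A
  | .tt => p
  | .ff => r
  | .node a q₁ q₂ => .node a (BasicForm.graft p r q₁) (BasicForm.graft p r q₂)

/-- The basic form of a propositional statement. -/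
def PS.basicForm : PS A → BasicForm A
  | .tt => .tt
  | .ff => .ff
  | .atom a => .node a .tt .ff
  | .cond p q r => BasicForm.graft p.basicForm r.basicForm q.basicForm

theorem deriv_cond_graft (Ax : PS A → PS A → Prop) (p r q : BasicForm A) :
    Deriv Ax (.cond p.toPS q.toPS r.toPS) (BasicForm.graft p r q).toPS := by
  induction q with
  | tt => exact .cp1 _ _
  | ff => exact .cp2 _ _
  | node a q₁ q₂ ih₁ ih₂ => exact .trans (.cp4 _ _ _ _ _) (.congr ih₁ (.refl _) ih₂)

theorem deriv_basicForm (Ax : PS A → PS A → Prop) (P : PS A) :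
    Deriv Ax P P.basicForm.toPS := by
  induction P with
  | tt => exact .refl _
  | ff => exact .refl _
  | atom a => exact .symm (.cp3 _)
  | cond p q r ihp ihq ihr => exact .trans (.congr ihp ihq ihr) (deriv_cond_graft Ax _ _ _)

theorem Deriv.sound {P Q : PS A} (h : Deriv NoAx P Q) (V : VA A) (H : V.Val) :
    P.eval V H = Q.eval V H ∧ P.deriv V H = Q.deriv V H := by
  induction h generalizing H with
  | ax h => exact h.elim
  | cp1 x y => simp [PS.eval, PS.deriv]
  | cp2 x y => simp [PS.eval, PS.deriv]
  | cp3 x => cases hx : x.eval V H <;> simp [PS.eval, PS.deriv, hx]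
  | cp4 x y z u v => cases hz : z.eval V H <;> simp [PS.eval, PS.deriv, hz]
  | refl x => exact ⟨rfl, rfl⟩
  | symm _ ih => exact ⟨(ih H).1.symm, (ih H).2.symm⟩
  | trans _ _ ih₁ ih₂ => exact ⟨(ih₁ H).1.trans (ih₂ H).1, (ih₁ H).2.trans (ih₂ H).2⟩
  | congr _ _ _ ihx ihy ihz => simp only [PS.eval, PS.deriv, ihx, ihy, ihz, and_self]

theorem PS.deriv_Tv (V : VA A) (P : PS A) : P.deriv V V.Tv = V.Tv := by
  induction P with
  | tt => rfl
  | ff => rfl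
  | atom a => exact V.dv_T a
  | cond p q r ihp ihq ihr => simp [PS.deriv, ihp, ihq, ihr]

theorem PS.deriv_Fv (V : VA A) (P : PS A) : P.deriv V V.Fv = V.Fv := by
  induction P with
  | tt => rfl
  | ff => rfl
  | atom a => exact V.dv_F a
  | cond p q r ihp ihq ihr => simp [PS.deriv, ihp, ihq, ihr]

/-- The valuation algebra whose valuations assign a truth value to each atom after each
sequence of previously evaluated atoms. -/
def historyVA (A : Type) : VA A where
  Val := List A → A → Bool
  Tv := fun _ _ => true
  Fv := fun _ _ => false
  yd := fun a H => H [] a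
  dv := fun a H w => H (a :: w)
  yd_T := fun _ => rfl
  yd_F := fun _ => rfl
  dv_T := fun _ => rfl
  dv_F := fun _ => rfl

/-- Two statements with the same evaluation over the history algebra, whose derivatives
also agree on all atoms. -/
def HistoryIndist (P Q : PS A) : Prop :=
  ∀ H : (historyVA A).Val, P.eval (historyVA A) H = Q.eval (historyVA A) H ∧
    ∀ c, (historyVA A).yd c (P.deriv (historyVA A) H) =
      (historyVA A).yd c (Q.deriv (historyVA A) H)

theorem HistoryIndist.symm {P Q : PS A} (h : HistoryIndist P Q) : HistoryIndist Q P :=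
  fun H => ⟨(h H).1.symm, fun c => ((h H).2 c).symm⟩

theorem deriv_cond_atom_of_dv_eq_Tv (V : VA A) (l r : PS A) (a : A) (H : V.Val)
    (h : V.dv a H = V.Tv) : (PS.cond l (.atom a) r).deriv V H = V.Tv := by
  simp [PS.deriv, h, PS.deriv_Tv]

theorem deriv_cond_atom_of_dv_eq_Fv (V : VA A) (l r : PS A) (a : A) (H : V.Val)
    (h : V.dv a H = V.Fv) : (PS.cond l (.atom a) r).deriv V H = V.Fv := by
  simp [PS.deriv, h, PS.deriv_Fv]

theorem not_historyIndist_cond_atom {P l r : PS A} {a : A}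
    (hP : ∀ H, P.deriv (historyVA A) H = H) :
    ¬ HistoryIndist P (.cond l (.atom a) r) := by
  intro h
  let H : (historyVA A).Val := fun w _ => !w.isEmpty
  have h₁ := (h H).2 a
  rw [hP, deriv_cond_atom_of_dv_eq_Tv _ l r a H rfl] at h₁
  exact Bool.false_ne_true h₁

theorem HistoryIndist.atom_eq {l r l' r' : PS A} {a b : A}
    (h : HistoryIndist (.cond l (.atom a) r) (.cond l' (.atom b) r')) : a = b := by
  classical
  by_contra hab
  let H : (historyVA A).Val := fun w _ => decide (w.head? = some a)
  have ha : (historyVA A).dv a H = (historyVA A).Tv := by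
    funext w c
    simp [historyVA, H]
  have hb : (historyVA A).dv b H = (historyVA A).Fv := by
    funext w c
    simp [historyVA, H, Ne.symm hab]
  have h₁ := (h H).2 a
  rw [deriv_cond_atom_of_dv_eq_Tv _ l r a H ha, deriv_cond_atom_of_dv_eq_Fv _ l' r' b H hb] at h₁
  exact Bool.false_ne_true h₁.symm

/-- The valuation with value `v` on all atoms first and behaving as `H` afterwards. -/
def historyVA.delay (v : Bool) (H : (historyVA A).Val) : (historyVA A).Val
  | [], _ => v
  | _ :: w, b => H w b

theorem HistoryIndist.left {l r l' r' : PS A} {a : A}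
    (h : HistoryIndist (.cond l (.atom a) r) (.cond l' (.atom a) r')) : HistoryIndist l l' := by
  intro H
  have h₁ := h (historyVA.delay true H)
  have hy : (historyVA A).yd a (historyVA.delay true H) = true := rfl
  have hd : (historyVA A).dv a (historyVA.delay true H) = H := rfl
  simpa only [PS.eval, PS.deriv, hy, hd, if_true] using h₁

theorem HistoryIndist.right {l r l' r' : PS A} {a : A}
    (h : HistoryIndist (.cond l (.atom a) r) (.cond l' (.atom a) r')) : HistoryIndist r r' := by
  intro H
  have h₁ := h (historyVA.delay false H)
  have hy : (historyVA A).yd a (historyVA.delay false H) = false := rfl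
  have hd : (historyVA A).dv a (historyVA.delay false H) = H := rfl
  simpa only [PS.eval, PS.deriv, hy, hd, Bool.false_eq_true, if_false] using h₁

theorem BasicForm.eq_of_historyIndist (t s : BasicForm A)
    (h : HistoryIndist t.toPS s.toPS) : t = s := by
  induction t generalizing s with
  | tt =>
    cases s with
    | tt => rfl
    | ff => exact absurd (h (historyVA A).Tv).1.symm Bool.false_ne_true
    | node a l r => exact (not_historyIndist_cond_atom (fun _ => rfl) h).elim
  | ff =>
    cases s with
    | tt => exact absurd (h (historyVA A).Tv).1 Bool.false_ne_true
    | ff => rfl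
    | node a l r => exact (not_historyIndist_cond_atom (fun _ => rfl) h).elim
  | node a l r ihl ihr =>
    cases s with
    | tt => exact (not_historyIndist_cond_atom (fun _ => rfl) h.symm).elim
    | ff => exact (not_historyIndist_cond_atom (fun _ => rfl) h.symm).elim
    | node b l' r' =>
      obtain rfl : a = b := HistoryIndist.atom_eq h
      rw [ihl l' (HistoryIndist.left h), ihr r' (HistoryIndist.right h)]

theorem KCong.historyIndist {P Q : PS A} (h : KCong frK P Q) : HistoryIndist P Q := by
  obtain ⟨R, ⟨hR, hcond⟩, hle, hPQ⟩ := h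
  refine fun H => ⟨hle P Q hPQ _ trivial H, fun c => ?_⟩
  have h₁ := hle _ _ (hcond (hR.refl (.atom c)) hPQ (hR.refl (.atom c))) (historyVA A) trivial H
  simpa only [PS.eval, ite_self] using h₁

/-- **Completeness of CP for free valuation congruence**: if `P =_fr Q`
(where `fr` is the class of all valuation algebras), then `CP ⊢ P = Q`. -/
theorem cp_completeness_fr {A : Type} [Countable A] [Nontrivial A]
    (P Q : PS A) (h : KCong frK P Q) : Deriv NoAx P Q := by
  have hPQ : P.basicForm = Q.basicForm := by
    refine BasicForm.eq_of_historyIndist _ _ fun H => ?_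
    obtain ⟨hP₁, hP₂⟩ := (deriv_basicForm NoAx P).sound (historyVA A) H
    obtain ⟨hQ₁, hQ₂⟩ := (deriv_basicForm NoAx Q).sound (historyVA A) H
    rw [← hP₁, ← hP₂, ← hQ₁, ← hQ₂]
    exact h.historyIndist H
  exact (deriv_basicForm NoAx P).trans (hPQ ▸ (deriv_basicForm NoAx Q).symm)
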